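/- Let a ∈ ℂ and N ∈ ℕ, and define (Vf)(x) = (x+a)(x+1−a−N)·f(x+1) − x(x+1)·f(x) for functions f : ℂ → ℂ. For n ∈ ℕ define sₙ : ℂ → ℂ by sₙ(x) = (x+a)ₙ, where (z)ₖ denotes the Pochhammer symbol. Then V acts bidiagonally on this basis: for every n ∈ ℕ and all x ∈ ℂ, (Vsₙ)(x) = (1−a−n)(n+a)·sₙ(x) + (n−N)·s_{n+1}(x). -/

import Mathlib

/-- The Pochhammer symbol `(z)ₖ = z (z+1) ⋯ (z+k-1)`. -/
noncomputable def poch (z : ℂ) (k : ℕ) : ℂ := ∏ i ∈ Finset.range k, (z + i)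

/-- The split basis `sₙ(x) = (x+a)ₙ`. -/
noncomputable def sFun (a : ℂ) (n : ℕ) (x : ℂ) : ℂ := poch (x + a) n

/-- The difference operator `V` of the Hahn realization. -/
noncomputable def Vop (a : ℂ) (N : ℕ) (f : ℂ → ℂ) : ℂ → ℂ :=
  fun x => (x + a) * (x + 1 - a - N) * f (x + 1) - x * (x + 1) * f x

theorem poch_succ (z : ℂ) (k : ℕ) : poch z (k + 1) = poch z k * (z + k) :=
  Finset.prod_range_succ _ k

theorem mul_poch_add_one (z : ℂ) (k : ℕ) : z * poch (z + 1) k = poch z (k + 1) := by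
  simp only [poch, Finset.prod_range_succ', Nat.cast_add, Nat.cast_one, Nat.cast_zero, add_zero]
  rw [mul_comm]
  congr 1
  exact Finset.prod_congr rfl fun i _ => by ring

/-- `V` acts bidiagonally on the split basis:
`V sₙ = (1 - a - n)(n + a) sₙ + (n - N) s_{n+1}`. -/
theorem V_bidiagonal (a : ℂ) (N : ℕ) (n : ℕ) (x : ℂ) :
    Vop a N (sFun a n) x =
      (1 - a - n) * (n + a) * sFun a n x + ((n : ℂ) - N) * sFun a (n + 1) x := by
  have shift : (x + a) * poch (x + 1 + a) n = poch (x + a) n * (x + a + n) := by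
    rw [add_right_comm, mul_poch_add_one, poch_succ]
  simp only [Vop, sFun, poch_succ]
  linear_combination (x + 1 - a - N) * shift
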